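/- arXiv:2503.03082 — 2 statements merged into one kernel-verified Lean document; each statement's English description precedes it below -/
import Mathlib

section
/- For any fixed m, any fixed k < m, any fixed p⃗ ∈ (0,1)^m, and any Thiele method Thiele_s (with nondecreasing, nonconstant score vector s), there exist constants c, C > 0 such that for all n ≥ 1, Pr_{P∼(π_{p⃗})^n}( Thiele_s(P) ⊆ CORE(P) ) ≥ 1 − C·e^{−c·n}. -/
/-- Probability of an approval set `A` under the independent approval distribution
`π_{p⃗}`: each alternative `i` is approved independently with probability `p i`. -/
noncomputable def iadProb (m : ℕ) (p : Fin m → ℝ) (A : Finset (Fin m)) : ℝ :=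
  (∏ i ∈ A, p i) * ∏ i ∈ Aᶜ, (1 - p i)

open Classical in
/-- Probability that a profile of `n` i.i.d. `π_{p⃗}` approval preferences satisfies
the event `Ev`. -/
noncomputable def prIAD (m n : ℕ) (p : Fin m → ℝ)
    (Ev : (Fin n → Finset (Fin m)) → Prop) : ℝ :=
  ∑ P : Fin n → Finset (Fin m), if Ev P then ∏ j, iadProb m p (P j) else 0

/-- The Thiele score of committee `W` at profile `P`. -/
def thieleScoreR {m : ℕ} (s : ℕ → ℝ) {n : ℕ} (P : Fin n → Finset (Fin m))
    (W : Finset (Fin m)) : ℝ :=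
  ∑ j, s ((P j ∩ W).card)

/-- `W` is in the core of the profile `P` of `n` agents. -/
def inCore (m k n : ℕ) (P : Fin n → Finset (Fin m)) (W : Finset (Fin m)) : Prop :=
  ∀ (S : Finset (Fin n)) (W' : Finset (Fin m)),
    S.Nonempty → W'.card * n ≤ S.card * k →
    ∃ j ∈ S, (P j ∩ W').card ≤ (P j ∩ W).card

section

open Finset Topology

/-- The expectation of `f` under the independent approval distribution. -/
noncomputable def iadExp {m : ℕ} (p : Fin m → ℝ) (f : Finset (Fin m) → ℝ) : ℝ :=
  ∑ A, iadProb m p A * f A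

section Distribution

variable {m : ℕ} {p : Fin m → ℝ}

theorem iadProb_pos (hp : ∀ i, 0 < p i ∧ p i < 1) (A : Finset (Fin m)) :
    0 < iadProb m p A :=
  mul_pos (prod_pos fun i _ => (hp i).1) (prod_pos fun i _ => by linarith [(hp i).2])

theorem sum_iadProb (p : Fin m → ℝ) : ∑ A, iadProb m p A = 1 := by
  have h := Finset.prod_add p (fun i => 1 - p i) univ
  simp only [add_sub_cancel, prod_const_one, powerset_univ] at h
  rw [h]
  exact sum_congr rfl fun A _ => by rw [iadProb, compl_eq_univ_sdiff]

theorem iadExp_const (p : Fin m → ℝ) (a : ℝ) : iadExp p (fun _ => a) = a := by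
  rw [iadExp, ← sum_mul, sum_iadProb, one_mul]

theorem iadExp_sub (p : Fin m → ℝ) (f g : Finset (Fin m) → ℝ) :
    iadExp p (fun A => f A - g A) = iadExp p f - iadExp p g := by
  simp only [iadExp, mul_sub, sum_sub_distrib]

theorem iadExp_sum {ι : Type*} (p : Fin m → ℝ) (I : Finset ι)
    (f : ι → Finset (Fin m) → ℝ) :
    iadExp p (fun A => ∑ i ∈ I, f i A) = ∑ i ∈ I, iadExp p (f i) := by
  simp only [iadExp, mul_sum]
  exact sum_comm

theorem iadExp_mono (hp : ∀ i, 0 < p i ∧ p i < 1) {f g : Finset (Fin m) → ℝ}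
    (h : ∀ A, f A ≤ g A) : iadExp p f ≤ iadExp p g :=
  sum_le_sum fun A _ => mul_le_mul_of_nonneg_left (h A) (iadProb_pos hp A).le

theorem map_swap_eq {i j : Fin m} {A : Finset (Fin m)} (hj : j ∈ A) (hi : i ∉ A) :
    A.map (Equiv.swap i j).toEmbedding = insert i (A.erase j) := by
  ext x
  rw [mem_map_equiv, Equiv.symm_swap, mem_insert, mem_erase]
  by_cases hxi : x = i
  · subst hxi; simp [hj]
  by_cases hxj : x = j
  · subst hxj; simp [hi, hxi]
  · simp [Equiv.swap_apply_of_ne_of_ne hxi hxj, hxi, hxj]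

theorem map_swap_eq_self {i j : Fin m} {A : Finset (Fin m)} (h : i ∈ A ↔ j ∈ A) :
    A.map (Equiv.swap i j).toEmbedding = A := by
  ext x
  rw [mem_map_equiv, Equiv.symm_swap]
  by_cases hxi : x = i
  · subst hxi; simp [h]
  by_cases hxj : x = j
  · subst hxj; simp [h]
  · simp [Equiv.swap_apply_of_ne_of_ne hxi hxj]

theorem map_swap_map_swap (i j : Fin m) (A : Finset (Fin m)) :
    (A.map (Equiv.swap i j).toEmbedding).map (Equiv.swap i j).toEmbedding = A := by
  ext x
  simp [mem_map_equiv]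

theorem card_map_inter (e : Fin m ≃ Fin m) (A B : Finset (Fin m)) :
    (A.map e.toEmbedding ∩ B).card = (A ∩ B.map e.symm.toEmbedding).card := by
  rw [← card_map (s := A ∩ B.map e.symm.toEmbedding) e.toEmbedding]
  congr 1
  ext x
  simp [mem_map_equiv]

theorem iadProb_eq_prod (p : Fin m → ℝ) (A : Finset (Fin m)) :
    iadProb m p A = ∏ i, if i ∈ A then p i else 1 - p i := by
  rw [prod_ite, iadProb]
  congr 2 <;> ext <;> simp

/-- Comparison of the probability of an approval set with that of its image under exchanging
two alternatives. -/
theorem iadProb_map_swap {i j : Fin m} {A : Finset (Fin m)} (hj : j ∈ A) (hi : i ∉ A) :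
    ∃ r : ℝ, ((∀ i, 0 < p i ∧ p i < 1) → 0 < r) ∧
      iadProb m p A - iadProb m p (A.map (Equiv.swap i j).toEmbedding) = r * (p j - p i) := by
  have hij : i ≠ j := fun h => hi (h ▸ hj)
  have split : ∀ f : Fin m → ℝ, ∏ x, f x = f i * (f j * ∏ x ∈ (univ.erase i).erase j, f x) := by
    intro f
    rw [mul_prod_erase _ f (mem_erase.2 ⟨hij.symm, mem_univ j⟩), mul_prod_erase _ f (mem_univ i)]
  refine ⟨∏ x ∈ (univ.erase i).erase j, if x ∈ A then p x else 1 - p x, ?_, ?_⟩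
  · intro hp
    refine prod_pos fun x _ => ?_
    split_ifs
    · exact (hp x).1
    · linarith [(hp x).2]
  · rw [iadProb_eq_prod, iadProb_eq_prod, split, split (fun x => if x ∈ A.map (Equiv.swap i j).toEmbedding then p x else 1 - p x),
      map_swap_eq hj hi]
    have hrest : ∏ x ∈ (univ.erase i).erase j,
        (if x ∈ insert i (A.erase j) then p x else 1 - p x) =
        ∏ x ∈ (univ.erase i).erase j, if x ∈ A then p x else 1 - p x := by
      refine prod_congr rfl fun x hx => ?_
      simp only [mem_erase] at hx
      simp [hx.1, hx.2.1]
    rw [hrest]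
    simp only [hi, hj, mem_insert, mem_erase, true_or, hij.symm, false_or, ne_eq, not_true,
      false_and, if_true, if_false]
    ring

theorem iadExp_swap_sub (p : Fin m → ℝ) (i j : Fin m) (g : Finset (Fin m) → ℝ) :
    2 * (iadExp p (fun A => g (A.map (Equiv.swap i j).toEmbedding)) - iadExp p g) =
      ∑ A : Finset (Fin m), (iadProb m p A - iadProb m p (A.map (Equiv.swap i j).toEmbedding)) *
        (g (A.map (Equiv.swap i j).toEmbedding) - g A) := by
  have key : ∀ F : Finset (Fin m) → ℝ,
      ∑ A : Finset (Fin m), F (A.map (Equiv.swap i j).toEmbedding) = ∑ A, F A := fun F =>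
    Equiv.sum_comp (Equiv.finsetCongr (Equiv.swap i j)) F
  have h1 := key fun A => iadProb m p A * g A
  have h2 := key fun A => iadProb m p A * g (A.map (Equiv.swap i j).toEmbedding)
  simp only [map_swap_map_swap] at h2
  simp only [iadExp, sub_mul, mul_sub, sum_sub_distrib, h1, h2]
  ring

theorem swap_term_nonneg (hp : ∀ i, 0 < p i ∧ p i < 1) {i j : Fin m} (hij : p i ≤ p j)
    {g : Finset (Fin m) → ℝ}
    (hg : ∀ A : Finset (Fin m), j ∈ A → i ∉ A → g A ≤ g (A.map (Equiv.swap i j).toEmbedding))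
    (A : Finset (Fin m)) :
    0 ≤ (iadProb m p A - iadProb m p (A.map (Equiv.swap i j).toEmbedding)) *
        (g (A.map (Equiv.swap i j).toEmbedding) - g A) := by
  have main : ∀ A : Finset (Fin m), j ∈ A → i ∉ A →
      0 ≤ (iadProb m p A - iadProb m p (A.map (Equiv.swap i j).toEmbedding)) *
        (g (A.map (Equiv.swap i j).toEmbedding) - g A) := by
    intro A hj hi
    obtain ⟨r, hr, h⟩ := iadProb_map_swap (p := p) hj hi
    rw [h]
    exact mul_nonneg (mul_nonneg (hr hp).le (by linarith)) (by linarith [hg A hj hi])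
  by_cases hj : j ∈ A <;> by_cases hi : i ∈ A
  · rw [map_swap_eq_self (by simp [hi, hj])]; simp
  · exact main A hj hi
  · have := main (A.map (Equiv.swap i j).toEmbedding) (by simpa [mem_map_equiv] using hi)
      (by simpa [mem_map_equiv] using hj)
    rw [map_swap_map_swap] at this
    linarith
  · rw [map_swap_eq_self (by simp [hi, hj])]; simp

/-- Exchanging an alternative for a more popular one increases the expectation of a function
that prefers approvals of the former. -/
theorem iadExp_le_swap (hp : ∀ i, 0 < p i ∧ p i < 1) {i j : Fin m} (hij : p i ≤ p j)
    {g : Finset (Fin m) → ℝ}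
    (hg : ∀ A : Finset (Fin m), j ∈ A → i ∉ A → g A ≤ g (A.map (Equiv.swap i j).toEmbedding)) :
    iadExp p g ≤ iadExp p (fun A => g (A.map (Equiv.swap i j).toEmbedding)) := by
  have h := iadExp_swap_sub p i j g
  have := sum_nonneg fun A (_ : A ∈ univ) => swap_term_nonneg hp hij hg A
  linarith

theorem iadExp_lt_swap (hp : ∀ i, 0 < p i ∧ p i < 1) {i j : Fin m} (hij : p i < p j)
    {g : Finset (Fin m) → ℝ}
    (hg : ∀ A : Finset (Fin m), j ∈ A → i ∉ A → g A ≤ g (A.map (Equiv.swap i j).toEmbedding))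
    {B : Finset (Fin m)} (hj : j ∈ B) (hi : i ∉ B)
    (hB : g B < g (B.map (Equiv.swap i j).toEmbedding)) :
    iadExp p g < iadExp p (fun A => g (A.map (Equiv.swap i j).toEmbedding)) := by
  have h := iadExp_swap_sub p i j g
  have : 0 < ∑ A : Finset (Fin m), (iadProb m p A - iadProb m p (A.map (Equiv.swap i j).toEmbedding)) *
        (g (A.map (Equiv.swap i j).toEmbedding) - g A) := by
    refine sum_pos' (fun A _ => swap_term_nonneg hp hij.le hg A) ⟨B, mem_univ B, ?_⟩
    obtain ⟨r, hr, h⟩ := iadProb_map_swap (p := p) hj hi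
    rw [h]
    exact mul_pos (mul_pos (hr hp) (by linarith)) (by linarith)
  linarith

theorem card_map_swap_inter {i j : Fin m} {A W : Finset (Fin m)} (hj : j ∈ A) (hi : i ∉ A)
    (hiW : i ∈ W) (hjW : j ∉ W) :
    (A.map (Equiv.swap i j).toEmbedding ∩ W).card = (A ∩ W).card + 1 := by
  have : A.map (Equiv.swap i j).toEmbedding ∩ W = insert i (A ∩ W) := by
    rw [map_swap_eq hj hi]
    ext x
    simp only [mem_inter, mem_insert, mem_erase]
    constructor
    · rintro ⟨h | h, hW⟩
      · exact Or.inl h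
      · exact Or.inr ⟨h.2, hW⟩
    · rintro (rfl | h)
      · exact ⟨Or.inl rfl, hiW⟩
      · exact ⟨Or.inr ⟨fun hx => hjW (hx ▸ h.2), h.1⟩, h.2⟩
  rw [this, card_insert_of_notMem (by simp [hi])]

end Distribution

section Majority

variable {m : ℕ} {p : Fin m → ℝ}

/-- Indicator that `U` contains a strict majority of the approvals that `A` has in `T`. -/
def majority (T U A : Finset (Fin m)) : ℝ :=
  if (A ∩ T).card < 2 * (A ∩ U).card then 1 else 0

theorem iadExp_majority_le_swap (hp : ∀ i, 0 < p i ∧ p i < 1) {T U : Finset (Fin m)}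
    {i j : Fin m} (hij : p i ≤ p j) (hiT : i ∈ T) (hjT : j ∈ T) (hi : i ∈ U) (hj : j ∉ U) :
    iadExp p (majority T U) ≤
      iadExp p (majority T (U.map (Equiv.swap i j).toEmbedding)) := by
  have hT : ∀ A : Finset (Fin m),
      (A.map (Equiv.swap i j).toEmbedding ∩ T).card = (A ∩ T).card := fun A => by
    rw [card_map_inter, Equiv.symm_swap, map_swap_eq_self (by simp [hiT, hjT])]
  have h := iadExp_le_swap hp hij (g := majority T U) fun A hjA hiA => by
    unfold majority
    rw [hT, card_map_swap_inter hjA hiA hi hj]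
    split_ifs <;> linarith
  refine h.trans (le_of_eq ?_)
  congr 1
  funext A
  unfold majority
  rw [hT, card_map_inter, Equiv.symm_swap]

theorem iadExp_majority_le (hp : ∀ i, 0 < p i ∧ p i < 1) {T U' : Finset (Fin m)}
    (hU' : U' ⊆ T) : ∀ (d : ℕ) (U : Finset (Fin m)), (U \ U').card = d → U ⊆ T →
    U.card = U'.card → (∀ i ∈ U \ U', ∀ j ∈ U' \ U, p i ≤ p j) →
    iadExp p (majority T U) ≤ iadExp p (majority T U') := by
  intro d
  induction d with
  | zero =>
    intro U hd _ hc _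
    rw [card_eq_zero, sdiff_eq_empty_iff_subset] at hd
    rw [eq_of_subset_of_card_le hd hc.ge]
  | succ d ih =>
    intro U hd hU hc hle
    have hd' : (U' \ U).card = d + 1 := by
      rw [← hd, card_sdiff_comm hc]
    obtain ⟨i, hi⟩ := card_pos.1 (hd.symm.subst d.succ_pos : 0 < (U \ U').card)
    obtain ⟨j, hj⟩ := card_pos.1 (hd'.symm.subst d.succ_pos : 0 < (U' \ U).card)
    have hi' := mem_sdiff.1 hi
    have hj' := mem_sdiff.1 hj
    refine (iadExp_majority_le_swap hp (hle i hi j hj) (hU hi'.1) (hU' hj'.1) hi'.1 hj'.2).trans ?_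
    rw [Equiv.swap_comm, map_swap_eq hi'.1 hj'.2]
    have h1 : insert j (U.erase i) \ U' = (U \ U').erase i := by
      ext x
      simp only [mem_sdiff, mem_insert, mem_erase]
      constructor
      · rintro ⟨rfl | h, h2⟩
        · exact absurd hj'.1 h2
        · exact ⟨h.1, h.2, h2⟩
      · rintro ⟨h1, h2, h3⟩
        exact ⟨Or.inr ⟨h1, h2⟩, h3⟩
    refine ih _ ?_ ?_ ?_ ?_
    · rw [h1, card_erase_of_mem hi, hd]; rfl
    · exact insert_subset (hU' hj'.1) ((erase_subset _ _).trans hU)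
    · rw [card_insert_of_notMem (fun h => hj'.2 (mem_of_mem_erase h)),
        card_erase_add_one hi'.1, hc]
    · intro x hx y hy
      rw [h1] at hx
      refine hle x (mem_of_mem_erase hx) y (mem_sdiff.2 ⟨(mem_sdiff.1 hy).1, fun hyU => ?_⟩)
      refine (mem_sdiff.1 hy).2 (mem_insert_of_mem (mem_erase.2 ⟨?_, hyU⟩))
      rintro rfl
      exact hi'.2 (mem_sdiff.1 hy).1

/-- By the Erdős–Ko–Rado theorem, few sets of a given size hold a majority. -/
theorem card_majority_le (A : Finset (Fin m)) (T : Finset (Fin m)) {N a : ℕ} (hN : T.card = N)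
    (ha : a ≤ N / 2) :
    ∑ B ∈ powersetCard a (univ : Finset (Fin N)),
      majority T (B.map (T.orderEmbOfFin hN).toEmbedding) A ≤ ((N - 1).choose (a - 1) : ℕ) := by
  unfold majority
  rw [sum_boole]
  norm_cast
  refine erdos_ko_rado ?_ ?_ ha
  · intro B hB C hC hdisj
    simp only [coe_filter, Set.mem_ofPred_eq] at hB hC
    have hsub : ∀ B : Finset (Fin N), B.map (T.orderEmbOfFin hN).toEmbedding ⊆ T := by
      intro B x hx
      obtain ⟨y, _, rfl⟩ := mem_map.1 hx
      exact orderEmbOfFin_mem T hN y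
    have hd : Disjoint (A ∩ B.map (T.orderEmbOfFin hN).toEmbedding)
        (A ∩ C.map (T.orderEmbOfFin hN).toEmbedding) :=
      ((disjoint_map _).2 hdisj).mono inter_subset_right inter_subset_right
    have := card_le_card (union_subset (inter_subset_inter_left (s := A) (hsub B))
      (inter_subset_inter_left (hsub C)))
    rw [card_union_of_disjoint hd] at this
    omega
  · intro B hB
    simp only [coe_filter, Set.mem_ofPred_eq, mem_powersetCard] at hB
    exact hB.1.2

/-- A set of `a` alternatives that are the least popular ones in `T` holds a majority of the
approvals in `T` with probability at most `a / |T|`. -/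
theorem iadExp_majority_mul_le (hp : ∀ i, 0 < p i ∧ p i < 1) {T U : Finset (Fin m)}
    (hU : U ⊆ T) (hne : U.Nonempty) (hcard : 2 * U.card ≤ T.card)
    (hle : ∀ i ∈ U, ∀ j ∈ T \ U, p i ≤ p j) :
    iadExp p (majority T U) * T.card ≤ U.card := by
  have hpos := hne.card_pos
  obtain ⟨a, ha⟩ : ∃ a, U.card = a + 1 := ⟨U.card - 1, by omega⟩
  obtain ⟨N, hN⟩ : ∃ N, T.card = N + 1 := ⟨T.card - 1, by omega⟩
  have h1 : ∀ B ∈ powersetCard (a + 1) (univ : Finset (Fin (N + 1))),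
      iadExp p (majority T U) ≤
        iadExp p (majority T (B.map (T.orderEmbOfFin hN).toEmbedding)) := by
    intro B hB
    have hsub : B.map (T.orderEmbOfFin hN).toEmbedding ⊆ T := by
      intro x hx
      obtain ⟨y, _, rfl⟩ := mem_map.1 hx
      exact orderEmbOfFin_mem T hN y
    refine iadExp_majority_le hp hsub _ U rfl hU ?_ ?_
    · rw [card_map, (mem_powersetCard.1 hB).2, ha]
    · intro i hi j hj
      rw [mem_sdiff] at hi hj
      exact hle i hi.1 j (mem_sdiff.2 ⟨hsub hj.1, hj.2⟩)
  have h2 := card_nsmul_le_sum _ _ _ h1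
  have h3 := iadExp_mono hp fun A => card_majority_le A T hN (a := a + 1) (by omega)
  rw [iadExp_sum, iadExp_const] at h3
  have h4 := h2.trans h3
  rw [card_powersetCard, card_univ, Fintype.card_fin, nsmul_eq_mul] at h4
  simp only [Nat.add_sub_cancel] at h4
  have h5 : ((N : ℝ) + 1) * N.choose a = (N + 1).choose (a + 1) * (a + 1) := by
    exact_mod_cast Nat.add_one_mul_choose_eq N a
  have h6 : (0 : ℝ) < N.choose a := by
    exact_mod_cast Nat.choose_pos (by omega)
  rw [hN, ha]
  push_cast
  have h7 : N.choose a * (iadExp p (majority T U) * (N + 1)) ≤ (N.choose a : ℝ) * (a + 1) := by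
    calc N.choose a * (iadExp p (majority T U) * (N + 1))
        = ((N + 1) * N.choose a) * iadExp p (majority T U) := by ring
      _ = ((N + 1).choose (a + 1) * iadExp p (majority T U)) * (a + 1) := by rw [h5]; ring
      _ ≤ N.choose a * (a + 1) := by gcongr
  exact le_of_mul_le_mul_left h7 h6

end Majority

section Concentration

variable {m : ℕ} {p : Fin m → ℝ}

theorem sum_prod_iadProb (n : ℕ) (p : Fin m → ℝ) :
    ∑ P : Fin n → Finset (Fin m), ∏ j, iadProb m p (P j) = 1 := by
  rw [← Fintype.sum_pow, sum_iadProb, one_pow]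

theorem prIAD_eq_one_sub (n : ℕ) (p : Fin m → ℝ) (Ev : (Fin n → Finset (Fin m)) → Prop) :
    prIAD m n p Ev = 1 - prIAD m n p (fun P => ¬ Ev P) := by
  rw [← sum_prod_iadProb n p, eq_sub_iff_add_eq, prIAD, prIAD, ← sum_add_distrib]
  refine sum_congr rfl fun P _ => ?_
  by_cases h : Ev P <;> simp [h]

theorem prIAD_le_sum {ι : Type*} (hp : ∀ i, 0 < p i ∧ p i < 1) (n : ℕ) (I : Finset ι)
    (Ev : (Fin n → Finset (Fin m)) → Prop) (F : ι → (Fin n → Finset (Fin m)) → Prop)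
    (h : ∀ P, Ev P → ∃ i ∈ I, F i P) :
    prIAD m n p Ev ≤ ∑ i ∈ I, prIAD m n p (F i) := by
  classical
  unfold prIAD
  rw [sum_comm]
  refine sum_le_sum fun P _ => ?_
  have hpos : 0 ≤ ∏ j, iadProb m p (P j) := prod_nonneg fun j _ => (iadProb_pos hp _).le
  have hnn : ∀ i ∈ I, 0 ≤ if F i P then ∏ j, iadProb m p (P j) else 0 := fun i _ => by
    split_ifs <;> simp [hpos]
  by_cases hE : Ev P
  · obtain ⟨i, hi, hF⟩ := h P hE
    refine le_trans ?_ (single_le_sum hnn hi)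
    simp [hE, hF]
  · simpa [hE] using sum_nonneg hnn

/-- The moment generating function of a function with positive mean dips below one. -/
theorem exists_mgf_lt_one {f : Finset (Fin m) → ℝ} (hf : 0 < iadExp p f) :
    ∃ t : ℝ, 0 < t ∧ iadExp p (fun A => Real.exp (-(t * f A))) < 1 := by
  have hd : HasDerivAt (fun t : ℝ => iadExp p (fun A => Real.exp (-(t * f A))))
      (-iadExp p f) 0 := by
    unfold iadExp
    rw [← sum_neg_distrib]
    refine HasDerivAt.fun_sum fun A _ => ?_
    have := ((((hasDerivAt_id (0 : ℝ)).mul_const (f A)).neg).exp).const_mul (iadProb m p A)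
    simpa using this
  have h := hasDerivWithinAt_iff_tendsto_slope.1 (hd.hasDerivWithinAt (s := Set.Ioi 0))
  rw [Set.sdiff_singleton_eq_self Set.self_notMem_Ioi] at h
  obtain ⟨t, hst, ht⟩ :=
    ((h.eventually_lt_const (neg_lt_zero.2 hf)).and self_mem_nhdsWithin).exists
  refine ⟨t, ht, ?_⟩
  rw [slope_def_field, sub_zero, div_lt_iff₀ ht, zero_mul, sub_neg] at hst
  simpa [iadExp_const] using hst

/-- Chernoff's bound for the sum of a function of the votes. -/
theorem prIAD_sum_nonpos_le (hp : ∀ i, 0 < p i ∧ p i < 1) {f : Finset (Fin m) → ℝ}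
    (hf : 0 < iadExp p f) :
    ∃ c : ℝ, 0 < c ∧ ∀ n : ℕ,
      prIAD m n p (fun P => ∑ j, f (P j) ≤ 0) ≤ Real.exp (-(c * n)) := by
  obtain ⟨t, ht, hM⟩ := exists_mgf_lt_one hf
  have hM0 : 0 < iadExp p (fun A => Real.exp (-(t * f A))) :=
    sum_pos (fun A _ => mul_pos (iadProb_pos hp A) (Real.exp_pos _)) univ_nonempty
  refine ⟨-Real.log (iadExp p (fun A => Real.exp (-(t * f A)))),
    neg_pos.2 (Real.log_neg hM0 hM), fun n => ?_⟩
  rw [neg_mul, neg_neg, mul_comm, ← Real.log_pow, Real.exp_log (pow_pos hM0 n), iadExp,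
    Fintype.sum_pow, prIAD]
  refine sum_le_sum fun P _ => ?_
  rw [prod_mul_distrib, ← Real.exp_sum]
  have hpos : 0 ≤ ∏ j, iadProb m p (P j) := prod_nonneg fun j _ => (iadProb_pos hp _).le
  split_ifs with h
  · refine le_mul_of_one_le_right hpos (Real.one_le_exp ?_)
    rw [sum_neg_distrib, ← mul_sum]
    have := mul_nonpos_of_nonneg_of_nonpos ht.le h
    linarith
  · exact mul_nonneg hpos (Real.exp_pos _).le

/-- If the failure of an event forces one of finitely many functions with positive mean to have
a nonpositive sum, then the event holds with exponentially high probability. -/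
theorem exists_exp_bound {ι : Type*} [Fintype ι] (hp : ∀ i, 0 < p i ∧ p i < 1)
    (Ev : ∀ n, (Fin n → Finset (Fin m)) → Prop) (f : ι → Finset (Fin m) → ℝ)
    (hf : ∀ i, 0 < iadExp p (f i))
    (h : ∀ n, 1 ≤ n → ∀ P, ¬ Ev n P → ∃ i, ∑ j, f i (P j) ≤ 0) :
    ∃ c C : ℝ, 0 < c ∧ 0 < C ∧ ∀ n : ℕ, 1 ≤ n →
      1 - C * Real.exp (-(c * n)) ≤ prIAD m n p (Ev n) := by
  choose c hc hcn using fun i => prIAD_sum_nonpos_le hp (hf i)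
  obtain ⟨d, hd, hdc⟩ : ∃ d : ℝ, 0 < d ∧ ∀ i, d ≤ c i := by
    rcases isEmpty_or_nonempty ι with hι | hι
    · exact ⟨1, one_pos, fun i => isEmptyElim i⟩
    · obtain ⟨i, hi⟩ := Finite.exists_min c
      exact ⟨c i, hc i, hi⟩
  refine ⟨d, Fintype.card ι + 1, hd, by positivity, fun n hn => ?_⟩
  rw [prIAD_eq_one_sub]
  have h1 := prIAD_le_sum hp n univ (fun P => ¬ Ev n P) (fun i P => ∑ j, f i (P j) ≤ 0)
    fun P hP => by simpa using h n hn P hP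
  have h2 : ∑ i, prIAD m n p (fun P => ∑ j, f i (P j) ≤ 0) ≤
      ∑ _i : ι, Real.exp (-(d * n)) := by
    refine sum_le_sum fun i _ => (hcn i n).trans (Real.exp_le_exp.2 ?_)
    have := mul_le_mul_of_nonneg_right (hdc i) (Nat.cast_nonneg (α := ℝ) n)
    linarith
  rw [sum_const, card_univ, nsmul_eq_mul] at h2
  have := Real.exp_pos (-(d * n))
  linarith

end Concentration

section Committees

variable {m k : ℕ} {p : Fin m → ℝ}

/-- Replacing a member of a committee by a more popular alternative strictly increases the
expected score. -/
theorem iadExp_score_lt_swap (hp : ∀ i, 0 < p i ∧ p i < 1) {s : ℕ → ℝ}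
    (hmono : ∀ i < k, s i ≤ s (i + 1)) (hnc : ∃ i < k, s i ≠ s (i + 1))
    {W : Finset (Fin m)} (hW : W.card = k) {i j : Fin m} (hi : i ∈ W) (hj : j ∉ W)
    (hij : p i < p j) :
    iadExp p (fun A => s (A ∩ W).card) <
      iadExp p (fun A => s (A ∩ W.map (Equiv.swap i j).toEmbedding).card) := by
  obtain ⟨r, hr, hne⟩ := hnc
  have hcard : (W.erase i).card = k - 1 := by rw [card_erase_of_mem hi, hW]
  obtain ⟨D, hD, hDr⟩ := exists_subset_card_eq (s := W.erase i) (n := r) (by omega)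
  have hiD : i ∉ D := fun h => notMem_erase i W (hD h)
  have hne' : i ≠ j := fun h => hj (h ▸ hi)
  have hBW : (insert j D ∩ W).card = r := by
    rw [insert_inter_of_notMem hj, inter_eq_left.2 (hD.trans (erase_subset _ _)), hDr]
  have h := iadExp_lt_swap hp hij (g := fun A => s (A ∩ W).card) (B := insert j D)
    (fun A hjA hiA => by
      rw [card_map_swap_inter hjA hiA hi hj]
      refine hmono _ (hW ▸ card_lt_card ?_)
      exact ⟨inter_subset_right, fun hs => hiA (mem_inter.1 (hs hi)).1⟩)
    (mem_insert_self j D) (by simp [hne', hiD]) (by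
      simp only [card_map_swap_inter (mem_insert_self j D)
        (by simp [hne', hiD] : i ∉ insert j D) hi hj, hBW]
      exact lt_of_le_of_ne (hmono r hr) hne)
  simpa only [card_map_inter, Equiv.symm_swap] using h

theorem card_inter_eq_sdiff (A W W' : Finset (Fin m)) :
    (A ∩ W).card = (A ∩ (W \ W')).card + (A ∩ (W ∩ W')).card := by
  rw [← card_union_of_disjoint]
  · rw [← inter_union_distrib_left, sdiff_union_inter]
  · exact (disjoint_sdiff_inter W W').mono inter_subset_right inter_subset_right

/-- A deviation from a committee of most popular alternatives is on average supported by too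
few voters to block. -/
theorem iadExp_majority_lt (hp : ∀ i, 0 < p i ∧ p i < 1) {W W' : Finset (Fin m)}
    (hW : W.card = k) (hW' : W'.card ≤ k) (hne : (W' \ W).Nonempty)
    (hle : ∀ i ∈ W, ∀ j ∉ W, p j ≤ p i) :
    iadExp p (majority (W' \ W ∪ W \ W') (W' \ W)) * k < W'.card := by
  have hdisj : Disjoint (W' \ W) (W \ W') := disjoint_sdiff_sdiff
  have h1 := card_sdiff_add_card_inter W W'
  have h2 := card_sdiff_add_card_inter W' W
  rw [inter_comm W' W] at h2
  have ha := hne.card_pos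
  have hT : (W' \ W ∪ W \ W').card = (W' \ W).card + (W \ W').card :=
    card_union_of_disjoint hdisj
  have h := iadExp_majority_mul_le hp (T := W' \ W ∪ W \ W') (U := W' \ W)
    subset_union_left hne (by omega) (fun i hi j hj => by
      simp only [mem_sdiff, mem_union] at hi hj
      exact hle j (by tauto) i hi.2)
  rw [hT] at h
  generalize iadExp p (majority (W' \ W ∪ W \ W') (W' \ W)) = e at h ⊢
  rw [← hW, ← h1, ← h2]
  have hab : ((W' \ W).card : ℝ) ≤ (W \ W').card := by exact_mod_cast (by omega)
  have ha' : (0 : ℝ) < (W' \ W).card := by exact_mod_cast ha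
  have ht : (0 : ℝ) ≤ (W ∩ W').card := Nat.cast_nonneg _
  push_cast at h ⊢
  generalize ((W' \ W).card : ℝ) = a at *
  generalize ((W \ W').card : ℝ) = b at *
  generalize ((W ∩ W').card : ℝ) = t at *
  have hpos : 0 < a + b := by linarith
  have he : e ≤ a / (a + b) := by rwa [le_div_iff₀ hpos]
  calc e * (b + t) ≤ a / (a + b) * (b + t) := by gcongr; linarith
    _ < a + t := by
      rw [div_mul_eq_mul_div, div_lt_iff₀ hpos]
      nlinarith [mul_nonneg ht (ha'.le.trans hab)]

/-- Every way in which a winning committee can fail to be in the core is witnessed by a function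
with positive mean whose sum over the profile is nonpositive. -/
theorem exists_witness (hk : 1 ≤ k) (hp : ∀ i, 0 < p i ∧ p i < 1) {s : ℕ → ℝ}
    (hmono : ∀ i < k, s i ≤ s (i + 1)) (hnc : ∃ i < k, s i ≠ s (i + 1))
    (W W' : Finset (Fin m)) :
    ∃ f : Finset (Fin m) → ℝ, 0 < iadExp p f ∧
      ∀ n, 1 ≤ n → ∀ P : Fin n → Finset (Fin m), W.card = k →
        (∀ W₁ : Finset (Fin m), W₁.card = k → thieleScoreR s P W₁ ≤ thieleScoreR s P W) →
        ∀ S : Finset (Fin n), S.Nonempty → W'.card * n ≤ S.card * k →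
        (∀ j ∈ S, (P j ∩ W).card < (P j ∩ W').card) → ∑ j, f (P j) ≤ 0 := by
  have hone : 0 < iadExp p (fun _ => 1) := by rw [iadExp_const]; exact one_pos
  by_cases hW : W.card = k
  swap
  · exact ⟨_, hone, fun n _ P h => absurd h hW⟩
  by_cases hW' : W'.card ≤ k
  swap
  · refine ⟨_, hone, fun n hn P _ _ S _ hS => absurd hS (not_le.2 ?_)⟩
    have : S.card ≤ n := by simpa using card_le_univ S
    nlinarith
  rcases (W' \ W).eq_empty_or_nonempty with hne | hne
  · refine ⟨_, hone, fun n _ P _ _ S hS _ hb => ?_⟩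
    obtain ⟨j, hj⟩ := hS
    exact absurd (hb j hj)
      (not_lt.2 (card_le_card (inter_subset_inter_left (sdiff_eq_empty_iff_subset.1 hne))))
  by_cases hle : ∀ i ∈ W, ∀ j ∉ W, p j ≤ p i
  · refine ⟨fun A => W'.card / k - majority (W' \ W ∪ W \ W') (W' \ W) A, ?_, ?_⟩
    · rw [iadExp_sub, iadExp_const, sub_pos, lt_div_iff₀ (by exact_mod_cast hk)]
      exact iadExp_majority_lt hp hW hW' hne hle
    · intro n _ P _ _ S _ hS hb
      have hk' : (0 : ℝ) < k := by exact_mod_cast hk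
      have h1 : (S.card : ℝ) ≤ ∑ j, majority (W' \ W ∪ W \ W') (W' \ W) (P j) := by
        unfold majority
        rw [sum_boole]
        norm_cast
        refine card_le_card fun j hj => mem_filter.2 ⟨mem_univ j, ?_⟩
        have hlt := hb j hj
        have e1 := card_inter_eq_sdiff (P j) W W'
        have e2 := card_inter_eq_sdiff (P j) W' W
        rw [inter_comm W' W] at e2
        rw [inter_union_distrib_left]
        have := card_union_le (P j ∩ (W' \ W)) (P j ∩ (W \ W'))
        omega
      have h2 : (W'.card : ℝ) * n ≤ S.card * k := by exact_mod_cast hS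
      rw [sum_sub_distrib, sum_const, card_univ, Fintype.card_fin, nsmul_eq_mul, sub_nonpos]
      refine le_trans ?_ h1
      rw [mul_div_assoc', div_le_iff₀ hk']
      linarith
  · push Not at hle
    obtain ⟨i, hi, j, hj, hij⟩ := hle
    refine ⟨_, (iadExp_sub p _ _).symm ▸
      sub_pos.2 (iadExp_score_lt_swap hp hmono hnc hW hi hj hij), ?_⟩
    intro n _ P _ hmax S _ _ _
    rw [sum_sub_distrib, sub_nonpos]
    exact hmax _ (by rw [card_map, hW])

end Committees

end

/-- under any independent approval distribution with
`p⃗ ∈ (0,1)^m`, any Thiele method selects only core-stable committees with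
probability at least `1 − C·e^{−cn}`. -/
theorem thiele_satisfies_core (m k : ℕ) (hk : 1 ≤ k) (hkm : k < m)
    (p : Fin m → ℝ) (hp : ∀ i, 0 < p i ∧ p i < 1)
    (s : ℕ → ℝ) (hmono : ∀ i < k, s i ≤ s (i + 1))
    (hnc : ∃ i < k, s i ≠ s (i + 1)) :
    ∃ c C : ℝ, 0 < c ∧ 0 < C ∧ ∀ n : ℕ, 1 ≤ n →
      1 - C * Real.exp (-(c * n)) ≤
        prIAD m n p (fun P => ∀ W : Finset (Fin m),
          (W.card = k ∧ ∀ W' : Finset (Fin m), W'.card = k →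
            thieleScoreR s P W' ≤ thieleScoreR s P W) →
          inCore m k n P W) := by
  choose f hf hbad using exists_witness hk hp hmono hnc
  refine exists_exp_bound hp _ (fun w : Finset (Fin m) × Finset (Fin m) => f w.1 w.2)
    (fun w => hf w.1 w.2) fun n hn P hP => ?_
  simp only [inCore] at hP
  push Not at hP
  obtain ⟨W, ⟨hW, hmax⟩, S, W', hS, hcard, hb⟩ := hP
  exact ⟨(W, W'), hbad W W' n hn P hW hmax S hS hcard hb⟩
end

section
/- For any p ∈ (0,1) and any integers k₁, k₂ ≥ 1, if X and Y are independent binomial random variables with X ∼ Binomial(k₁, p) and Y ∼ Binomial(k₂, p), then Pr(X < Y) · (k₁/k₂) < 1, i.e., Pr(X < Y) < k₂/k₁. -/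
/-- Summing a function of the cardinalities of `A \ W` and `A ∩ W` over all `A`, where `A` is
decomposed along `W` and its complement. -/
lemma sum_apply_card_sdiff_card_inter {α M : Type*} [Fintype α] [DecidableEq α]
    [CommSemiring M] (W : Finset α) (g : ℕ → ℕ → M) :
    ∑ A : Finset α, g (A \ W).card (A ∩ W).card =
      ∑ s ∈ Finset.range (Wᶜ.card + 1), ∑ ℓ ∈ Finset.range (W.card + 1),
        (Wᶜ.card.choose s : M) * (W.card.choose ℓ : M) * g s ℓ := by
  have hsplit : ∑ A : Finset α, g (A \ W).card (A ∩ W).card =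
      ∑ x ∈ Wᶜ.powerset ×ˢ W.powerset, g x.1.card x.2.card := by
    refine Finset.sum_bij' (fun A _ => (A \ W, A ∩ W)) (fun x _ => x.1 ∪ x.2) ?_ ?_ ?_ ?_ ?_
    · intro A _
      simp only [Finset.mem_product, Finset.mem_powerset]
      exact ⟨fun a ha => by simp_all, Finset.inter_subset_right⟩
    · simp
    · intro A _
      exact Finset.sdiff_union_inter A W
    · rintro ⟨B, C⟩ h
      simp only [Finset.mem_product, Finset.mem_powerset] at h
      have hB : ∀ a ∈ B, a ∉ W := fun a ha => by simpa using h.1 ha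
      have hC : ∀ a ∈ C, a ∈ W := fun a ha => h.2 ha
      ext a <;> simp <;> grind
    · simp
  rw [hsplit, Finset.sum_product]
  have hinner : ∀ B : Finset α, ∑ C ∈ W.powerset, g B.card C.card =
      ∑ ℓ ∈ Finset.range (W.card + 1), (W.card.choose ℓ : M) * g B.card ℓ := fun B => by
    simpa using Finset.sum_powerset_apply_card (g B.card) (x := W)
  simp_rw [hinner]
  rw [Finset.sum_powerset_apply_card
    (fun s => ∑ ℓ ∈ Finset.range (W.card + 1), (W.card.choose ℓ : M) * g s ℓ) (x := Wᶜ)]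
  simp only [nsmul_eq_mul, Finset.mul_sum, mul_assoc]

/-- The probability that a binomial variable is less than an independent one, realised on a random
subset `A` of `α`: the successes of the second variable are the elements of `A` in `W`. -/
lemma binomial_lt_prob_eq_sum_finset {α : Type*} [Fintype α] [DecidableEq α] (p : ℝ)
    (k₁ k₂ : ℕ) (W : Finset α) (hW : W.card = k₂) (hα : Fintype.card α = k₁ + k₂) :
    (∑ s ∈ Finset.range k₂, ∑ ℓ ∈ Finset.Icc (s + 1) k₂,
        ((k₁.choose s : ℝ) * p ^ s * (1 - p) ^ (k₁ - s)) *
        ((k₂.choose ℓ : ℝ) * p ^ ℓ * (1 - p) ^ (k₂ - ℓ))) =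
      ∑ A : Finset α, if (A \ W).card < (A ∩ W).card then
        p ^ A.card * (1 - p) ^ (k₁ + k₂ - A.card) else 0 := by
  have hWc : Wᶜ.card = k₁ := by rw [Finset.card_compl]; omega
  have hcard : ∀ A : Finset α, A.card = (A \ W).card + (A ∩ W).card := fun A =>
    (Finset.card_sdiff_add_card_inter A W).symm
  have key := sum_apply_card_sdiff_card_inter W (fun s ℓ =>
    if s < ℓ then p ^ (s + ℓ) * (1 - p) ^ (k₁ + k₂ - (s + ℓ)) else 0)
  simp only [← hcard] at key
  rw [key, hWc, hW]
  have hextend : ∀ f : ℕ → ℝ, ∀ a b : ℕ, a ≤ b → (∀ s, a ≤ s → f s = 0) →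
      ∑ s ∈ Finset.range a, f s = ∑ s ∈ Finset.range b, f s := fun f a b hab hf =>
    Finset.sum_subset (Finset.range_mono hab) fun s _ hs => hf s (by simpa using hs)
  rw [hextend _ k₂ (k₁ + 1 + k₂) (by omega), hextend _ (k₁ + 1) (k₁ + 1 + k₂) (by omega)]
  · refine Finset.sum_congr rfl fun s _ => ?_
    have hIcc : Finset.Icc (s + 1) k₂ = (Finset.range (k₂ + 1)).filter (s < ·) := by
      ext; simp; omega
    rw [hIcc, Finset.sum_filter]
    refine Finset.sum_congr rfl fun ℓ hℓ => ?_
    split_ifs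
    · rcases le_or_gt s k₁ with hs | hs
      · have hℓ' : ℓ ≤ k₂ := by simpa [Nat.lt_succ_iff] using hℓ
        rw [show k₁ + k₂ - (s + ℓ) = (k₁ - s) + (k₂ - ℓ) by omega, pow_add, pow_add]
        ring
      · simp [Nat.choose_eq_zero_of_lt hs]
    · simp
  · intro s hs
    simp [Nat.choose_eq_zero_of_lt (show k₁ < s by omega)]
  · intro s hs
    rw [Finset.Icc_eq_empty (by omega), Finset.sum_empty]

/-- At most `(n - 1).choose (r - 1)` of the `r`-subsets of an `n`-set contain more than half of
the elements of a given set `A`, since such subsets pairwise intersect. -/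
lemma card_powersetCard_filter_majority_le {n r : ℕ} (hr : r ≤ n / 2) (A : Finset (Fin n)) :
    ((Finset.univ.powersetCard r).filter
      fun W : Finset (Fin n) => (A \ W).card < (A ∩ W).card).card ≤
      (n - 1).choose (r - 1) := by
  refine Finset.erdos_ko_rado ?_ ?_ hr
  · intro V hV W hW hVW
    simp only [Finset.coe_filter, Set.mem_ofPred_eq] at hV hW
    have hsub : A ∩ V ⊆ A \ W := fun a ha => by
      rw [Finset.mem_inter] at ha
      exact Finset.mem_sdiff.2 ⟨ha.1, Finset.disjoint_left.1 hVW ha.2⟩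
    have hsub' : A ∩ W ⊆ A \ V := fun a ha => by
      rw [Finset.mem_inter] at ha
      exact Finset.mem_sdiff.2 ⟨ha.1, Finset.disjoint_right.1 hVW ha.2⟩
    have h₁ := Finset.card_le_card hsub
    have h₂ := Finset.card_le_card hsub'
    omega
  · intro W hW
    simp only [Finset.coe_filter, Set.mem_ofPred_eq, Finset.mem_powersetCard] at hW
    exact hW.1.2

/-- if `X ∼ Binomial(k₁, p)` and `Y ∼ Binomial(k₂, p)` are
independent with `p ∈ (0,1)` and `k₁, k₂ ≥ 1`, then `Pr(X < Y) · (k₁/k₂) < 1`,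
where `Pr(X < Y)` is written out explicitly as a double sum. -/
theorem binomial_lt_prob_mul_ratio_lt_one (p : ℝ) (hp0 : 0 < p) (hp1 : p < 1)
    (k₁ k₂ : ℕ) (hk₁ : 1 ≤ k₁) (hk₂ : 1 ≤ k₂) :
    (∑ s ∈ Finset.range k₂, ∑ ℓ ∈ Finset.Icc (s + 1) k₂,
        ((k₁.choose s : ℝ) * p ^ s * (1 - p) ^ (k₁ - s)) *
        ((k₂.choose ℓ : ℝ) * p ^ ℓ * (1 - p) ^ (k₂ - ℓ)))
      * ((k₁ : ℝ) / (k₂ : ℝ)) < 1 := by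
  have hq : 0 < 1 - p := sub_pos.2 hp1
  have hk₁' : (0 : ℝ) < k₁ := by exact_mod_cast hk₁
  have hk₂' : (0 : ℝ) < k₂ := by exact_mod_cast hk₂
  have hP := binomial_lt_prob_eq_sum_finset (α := Fin (k₁ + k₂)) p k₁ k₂
  set P := ∑ s ∈ Finset.range k₂, ∑ ℓ ∈ Finset.Icc (s + 1) k₂,
        ((k₁.choose s : ℝ) * p ^ s * (1 - p) ^ (k₁ - s)) *
        ((k₂.choose ℓ : ℝ) * p ^ ℓ * (1 - p) ^ (k₂ - ℓ))
  have htotal : ∑ A : Finset (Fin (k₁ + k₂)), p ^ A.card * (1 - p) ^ (k₁ + k₂ - A.card) = 1 := by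
    simpa using Fintype.sum_pow_mul_eq_add_pow (Fin (k₁ + k₂)) p (1 - p)
  have hw : ∀ A : Finset (Fin (k₁ + k₂)), 0 < p ^ A.card * (1 - p) ^ (k₁ + k₂ - A.card) :=
    fun A => by positivity
  rw [← mul_div_assoc, div_lt_one hk₂']
  rcases lt_or_ge k₁ k₂ with hlt | hge
  · obtain ⟨W, -, hW⟩ := Finset.exists_subset_card_eq
      (s := (Finset.univ : Finset (Fin (k₁ + k₂)))) (n := k₂) (by simp)
    have hP1 : P < 1 := by
      rw [hP W hW (by simp)]
      refine lt_of_lt_of_eq ?_ htotal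
      apply Finset.sum_lt_sum
      · intro A _
        split_ifs
        · exact le_rfl
        · exact (hw A).le
      · exact ⟨∅, Finset.mem_univ _, by simpa using hw ∅⟩
    have : (k₁ : ℝ) < k₂ := by exact_mod_cast hlt
    nlinarith
  · have hle : ((k₁ + k₂).choose k₂ : ℝ) * P ≤ ((k₁ + k₂ - 1).choose (k₂ - 1) : ℝ) := by
      calc ((k₁ + k₂).choose k₂ : ℝ) * P
          = ∑ W ∈ (Finset.univ : Finset (Fin (k₁ + k₂))).powersetCard k₂, P := by simp
        _ = ∑ A : Finset (Fin (k₁ + k₂)),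
              (((Finset.univ.powersetCard k₂).filter
                fun W : Finset (Fin (k₁ + k₂)) => (A \ W).card < (A ∩ W).card).card : ℝ) *
              (p ^ A.card * (1 - p) ^ (k₁ + k₂ - A.card)) := by
            rw [Finset.sum_congr rfl fun W hW =>
              hP W (Finset.mem_powersetCard.1 hW).2 (by simp), Finset.sum_comm]
            refine Finset.sum_congr rfl fun A _ => ?_
            rw [← Finset.sum_filter, Finset.sum_const, nsmul_eq_mul]
        _ ≤ ∑ A : Finset (Fin (k₁ + k₂)), ((k₁ + k₂ - 1).choose (k₂ - 1) : ℝ) *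
              (p ^ A.card * (1 - p) ^ (k₁ + k₂ - A.card)) := by
            refine Finset.sum_le_sum fun A _ => mul_le_mul_of_nonneg_right ?_ (hw A).le
            exact_mod_cast card_powersetCard_filter_majority_le (by omega) A
        _ = ((k₁ + k₂ - 1).choose (k₂ - 1) : ℝ) := by rw [← Finset.mul_sum, htotal, mul_one]
    obtain ⟨m, rfl⟩ := Nat.exists_eq_add_of_le' hk₂
    have hchoose : ((k₁ + (m + 1) : ℕ) : ℝ) * ((k₁ + m).choose m : ℝ) =
        ((k₁ + (m + 1)).choose (m + 1) : ℝ) * ((m + 1 : ℕ) : ℝ) := by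
      exact_mod_cast Nat.add_one_mul_choose_eq (k₁ + m) m
    have hpos : (0 : ℝ) < ((k₁ + m).choose m : ℝ) := by
      exact_mod_cast Nat.choose_pos (Nat.le_add_left m k₁)
    have hpos' : (0 : ℝ) < ((k₁ + (m + 1)).choose (m + 1) : ℝ) := by
      exact_mod_cast Nat.choose_pos (Nat.le_add_left (m + 1) k₁)
    rw [show k₁ + (m + 1) - 1 = k₁ + m by omega, Nat.add_sub_cancel] at hle
    refine lt_of_mul_lt_mul_left ?_ hpos'.le
    calc ((k₁ + (m + 1)).choose (m + 1) : ℝ) * (P * k₁)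
        = ((k₁ + (m + 1)).choose (m + 1) : ℝ) * P * k₁ := by ring
      _ ≤ ((k₁ + m).choose m : ℝ) * k₁ := mul_le_mul_of_nonneg_right hle hk₁'.le
      _ < ((k₁ + (m + 1) : ℕ) : ℝ) * ((k₁ + m).choose m : ℝ) := by
          rw [mul_comm]
          refine mul_lt_mul_of_pos_right ?_ hpos
          exact_mod_cast Nat.lt_add_of_pos_right hk₂
      _ = _ := hchoose
end
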